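/- arXiv:2403.10174 — 2 statements merged into one kernel-verified Lean document; each statement's English description precedes it below -/
import Mathlib

section
/- Let γ ∈ ℝ, M ∈ Matrix (Fin 2) (Fin 2) ℂ, m ∈ ℂ, and define the block-diagonal action on v = (v₁,v₂,v₃) ∈ ℂ³ by μinv·v = (M·(v₁,v₂), m·v₃). Let F, F' : ℝ² → ℂ³ be differentiable with tangential parts F_t = (F₁,F₂), F'_t = (F'₁,F'₂) and tangential gradients g = (∂F₃/∂x, ∂F₃/∂y), g' = (∂F'₃/∂x, ∂F'₃/∂y). Then, pointwise, (μinv·curl_γ F) · conj(curl_γ F') = m·(∂F₂/∂x − ∂F₁/∂y)·conj(∂F'₂/∂x − ∂F'₁/∂y) + (M·(g×ẑ))·conj(g'×ẑ) + iγ·(M·(g×ẑ))·conj(F'_t×ẑ) − iγ·(M·(F_t×ẑ))·conj(g'×ẑ) + γ²·(M·(F_t×ẑ))·conj(F'_t×ẑ), where for u = (u₁,u₂) ∈ ℂ² one sets u×ẑ = (u₂,−u₁) ∈ ℂ², conj is componentwise complex conjugation, and · denotes the bilinear (unconjugated) dot product Σᵢ aᵢbᵢ. -/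
open Complex

/-- Partial derivative of a `ℂ³`-valued field on `ℝ²`. -/
noncomputable def pd2 (F : (Fin 2 → ℝ) → (Fin 3 → ℂ)) (i : Fin 2) (j : Fin 3)
    (p : Fin 2 → ℝ) : ℂ :=
  fderiv ℝ F p (Pi.single i 1) j

/-- The conical curl. -/
noncomputable def curlGamma (γ : ℝ) (F : (Fin 2 → ℝ) → (Fin 3 → ℂ))
    (p : Fin 2 → ℝ) : Fin 3 → ℂ :=
  ![pd2 F 1 2 p - Complex.I * (γ : ℂ) * F p 1,
    Complex.I * (γ : ℂ) * F p 0 - pd2 F 0 2 p,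
    pd2 F 0 1 p - pd2 F 1 0 p]

/-- Block-diagonal action `μinv·v = (M·(v₁,v₂), m·v₃)` on `ℂ³`. -/
noncomputable def blockAct (M : Matrix (Fin 2) (Fin 2) ℂ) (m : ℂ) (v : Fin 3 → ℂ) : Fin 3 → ℂ :=
  ![M.mulVec ![v 0, v 1] 0, M.mulVec ![v 0, v 1] 1, m * v 2]

/-- For `u = (u₁,u₂) ∈ ℂ²`, the rotation `u × ẑ = (u₂, −u₁)`. -/
noncomputable def crossZ (u : Fin 2 → ℂ) : Fin 2 → ℂ := ![u 1, -u 0]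

/-- Pointwise integrand decomposition underlying the weak formulation of the conical
direct problem (Corollary 1, Eq. (17)), with `M = (tilde μ_{r,t})⁻¹`, `m = μ_{r,zz}⁻¹`. -/
theorem weak_form_integrand_decomposition
    (γ : ℝ) (M : Matrix (Fin 2) (Fin 2) ℂ) (m : ℂ)
    (F F' : (Fin 2 → ℝ) → (Fin 3 → ℂ))
    (hF : Differentiable ℝ F) (hF' : Differentiable ℝ F')
    (p : Fin 2 → ℝ) :
    (∑ i, blockAct M m (curlGamma γ F p) i * starRingEnd ℂ (curlGamma γ F' p i))
    = m * (pd2 F 0 1 p - pd2 F 1 0 p) * starRingEnd ℂ (pd2 F' 0 1 p - pd2 F' 1 0 p)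
      + (∑ i, M.mulVec (crossZ ![pd2 F 0 2 p, pd2 F 1 2 p]) i
            * starRingEnd ℂ (crossZ ![pd2 F' 0 2 p, pd2 F' 1 2 p] i))
      + Complex.I * (γ : ℂ)
          * (∑ i, M.mulVec (crossZ ![pd2 F 0 2 p, pd2 F 1 2 p]) i
              * starRingEnd ℂ (crossZ ![F' p 0, F' p 1] i))
      - Complex.I * (γ : ℂ)
          * (∑ i, M.mulVec (crossZ ![F p 0, F p 1]) i
              * starRingEnd ℂ (crossZ ![pd2 F' 0 2 p, pd2 F' 1 2 p] i))
      + (γ : ℂ) ^ 2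
          * (∑ i, M.mulVec (crossZ ![F p 0, F p 1]) i
              * starRingEnd ℂ (crossZ ![F' p 0, F' p 1] i)) := by
  simp [Fin.sum_univ_three, Fin.sum_univ_two, blockAct, curlGamma, crossZ, Matrix.mulVec,
    dotProduct]
  linear_combination
    (-(γ : ℂ) ^ 2 * ((M 0 0 * F p 1 - M 0 1 * F p 0) * starRingEnd ℂ (F' p 1)
      - (M 1 0 * F p 1 - M 1 1 * F p 0) * starRingEnd ℂ (F' p 0))) * Complex.I_sq
end

section
/- Let n ∈ ℕ, t₀ ∈ ℝ, let A : ℝ → Matrix (Fin n) (Fin n) ℂ and b : ℝ → (Fin n → ℂ) be differentiable at t₀, and assume A(t₀) is invertible. Define u(t) = (A t)⁻¹ · (b t) and fix c : Fin n → ℂ. Let λ = ((A t₀)ᵀ)⁻¹ · c be the solution of the adjoint linear system (A t₀)ᵀ λ = c. Then the scalar function t ↦ Σᵢ cᵢ · uᵢ(t) is differentiable at t₀ and its derivative equals Σᵢ λᵢ · (b'(t₀) − A'(t₀)·u(t₀))ᵢ, where A'(t₀) and b'(t₀) are the derivatives of A and b at t₀ and · denotes matrix-vector multiplication. -/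
open scoped Matrix

section MatrixCalculus

variable {𝕜 R m : Type*} [NontriviallyNormedField 𝕜] [NormedField R] [NormedAlgebra 𝕜 R]
  [Fintype m] {A : 𝕜 → Matrix m m R} {t₀ : 𝕜}

theorem differentiableAt_matrix_det [DecidableEq m]
    (hA : ∀ i j, DifferentiableAt 𝕜 (fun t => A t i j) t₀) :
    DifferentiableAt 𝕜 (fun t => (A t).det) t₀ := by
  simp only [Matrix.det_apply']
  fun_prop

theorem differentiableAt_matrix_inv_apply [DecidableEq m]
    (hA : ∀ i j, DifferentiableAt 𝕜 (fun t => A t i j) t₀) (hinv : IsUnit (A t₀)) (i j : m) :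
    DifferentiableAt 𝕜 (fun t => (A t)⁻¹ i j) t₀ := by
  have hdet : (A t₀).det ≠ 0 := ((Matrix.isUnit_iff_isUnit_det _).1 hinv).ne_zero
  have hadj : DifferentiableAt 𝕜 (fun t => (A t).adjugate i j) t₀ := by
    simp only [Matrix.adjugate_apply]
    refine differentiableAt_matrix_det fun k l => ?_
    by_cases hk : k = j
    · subst hk
      simp
    · simpa [Matrix.updateRow_ne hk] using hA k l
  simp only [Matrix.inv_def, Ring.inverse_eq_inv', Matrix.smul_apply, smul_eq_mul]
  exact ((differentiableAt_matrix_det hA).inv hdet).mul hadj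

theorem eventually_isUnit_matrix [DecidableEq m]
    (hA : ∀ i j, DifferentiableAt 𝕜 (fun t => A t i j) t₀) (hinv : IsUnit (A t₀)) :
    ∀ᶠ t in nhds t₀, IsUnit (A t) := by
  simp only [Matrix.isUnit_iff_isUnit_det, isUnit_iff_ne_zero] at hinv ⊢
  exact (differentiableAt_matrix_det hA).continuousAt.eventually_ne hinv

/-- The sensitivity equation `A u' = b' - A' u` of a parametrized linear system `A u = b`. -/
theorem mulVec_deriv_eq_of_mulVec_eventuallyEq {u b : 𝕜 → m → R} {b' : m → R}
    (hA : ∀ i j, DifferentiableAt 𝕜 (fun t => A t i j) t₀)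
    (hu : DifferentiableAt 𝕜 u t₀) (hb : HasDerivAt b b' t₀)
    (h : ∀ᶠ t in nhds t₀, A t *ᵥ u t = b t) :
    A t₀ *ᵥ deriv u t₀ =
      b' - (Matrix.of fun i j => deriv (fun t => A t i j) t₀) *ᵥ u t₀ := by
  ext i
  have hAu : HasDerivAt (fun t => ∑ j, A t i j * u t j)
      (∑ j, (deriv (fun t => A t i j) t₀ * u t₀ j + A t₀ i j * deriv u t₀ j)) t₀ :=
    HasDerivAt.fun_sum fun j _ =>
      (hA i j).hasDerivAt.mul (hasDerivAt_pi.1 hu.hasDerivAt j)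
  have heq : (fun t => b t i) =ᶠ[nhds t₀] fun t => ∑ j, A t i j * u t j := by
    filter_upwards [h] with t ht
    rw [← ht]
    rfl
  have key := (hasDerivAt_pi.1 hb i).unique (hAu.congr_of_eventuallyEq heq)
  simp [Matrix.mulVec, dotProduct, key, Finset.sum_add_distrib]

end MatrixCalculus

/-- Discrete adjoint method: the derivative of the linear performance functional
`t ↦ c · u(t)` of the solution `u(t) = A(t)⁻¹ b(t)` of a parametrized linear system is
`λ · (b'(t₀) − A'(t₀) u(t₀))` where `λ` solves the adjoint system `A(t₀)ᵀ λ = c`. -/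
theorem discrete_adjoint_method (n : ℕ) (t₀ : ℝ)
    (A : ℝ → Matrix (Fin n) (Fin n) ℂ) (b : ℝ → (Fin n → ℂ))
    (hA : ∀ i j, DifferentiableAt ℝ (fun t => A t i j) t₀)
    (hb : DifferentiableAt ℝ b t₀)
    (hinv : IsUnit (A t₀))
    (c : Fin n → ℂ)
    (u : ℝ → (Fin n → ℂ)) (hu : ∀ t, u t = (A t)⁻¹.mulVec (b t))
    (lam : Fin n → ℂ) (hlam : lam = ((A t₀)ᵀ)⁻¹.mulVec c) :
    HasDerivAt (fun t => ∑ i, c i * u t i)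
      (∑ i, lam i *
        (deriv b t₀
          - (Matrix.of fun i j => deriv (fun t => A t i j) t₀).mulVec (u t₀)) i) t₀ := by
  have hdu : DifferentiableAt ℝ u t₀ := by
    rw [funext hu]
    refine differentiableAt_pi.2 fun i => ?_
    simp only [Matrix.mulVec, dotProduct]
    refine DifferentiableAt.fun_sum fun j _ => ?_
    exact (differentiableAt_matrix_inv_apply hA hinv i j).mul (differentiableAt_pi.1 hb j)
  have hsol : ∀ᶠ t in nhds t₀, A t *ᵥ u t = b t := by
    filter_upwards [eventually_isUnit_matrix hA hinv] with t ht
    rw [hu, Matrix.mulVec_mulVec,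
      Matrix.mul_nonsing_inv _ ((Matrix.isUnit_iff_isUnit_det _).1 ht), Matrix.one_mulVec]
  have hadj : lam ᵥ* A t₀ = c := by
    rw [← Matrix.mulVec_transpose, hlam, Matrix.mulVec_mulVec, Matrix.mul_nonsing_inv,
      Matrix.one_mulVec]
    rwa [Matrix.det_transpose, ← Matrix.isUnit_iff_isUnit_det]
  rw [← mulVec_deriv_eq_of_mulVec_eventuallyEq hA hdu hb.hasDerivAt hsol]
  change HasDerivAt _ (lam ⬝ᵥ A t₀ *ᵥ deriv u t₀) t₀
  rw [Matrix.dotProduct_mulVec, hadj]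
  exact HasDerivAt.fun_sum fun i _ => (hasDerivAt_pi.1 hdu.hasDerivAt i).const_mul (c i)
end
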